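/- Let Z be a Banach algebra, A, B closed subalgebras with the length-d approximate factorization property with constant C (as in Lemma 22), let σ : Z → B(H) be a bounded representation and Δ : Z → B(H) a bounded σ-derivation (Δ(z₁z₂) = σ(z₁)Δ(z₂) + Δ(z₁)σ(z₂)). Then ‖Δ‖ ≤ C·d·max(‖σ‖,1)^{d−1}·max(‖Δ|_A‖, ‖Δ|_B‖). -/

import Mathlib

variable {Z : Type*} [NormedRing Z] [NormedAlgebra ℂ Z]

/-- Alternating word starting in `B`. -/
def AltB (A B : Subalgebra ℂ Z) {k : ℕ} (x : Fin k → Z) : Prop :=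
  ∀ i : Fin k, (i.val % 2 = 0 → x i ∈ B) ∧ (i.val % 2 = 1 → x i ∈ A)

/-- Alternating word starting in `A`. -/
def AltA (A B : Subalgebra ℂ Z) {k : ℕ} (x : Fin k → Z) : Prop :=
  ∀ i : Fin k, (i.val % 2 = 0 → x i ∈ A) ∧ (i.val % 2 = 1 → x i ∈ B)

open Filter Topology in
theorem le_of_continuous_of_forall_gt {f : ℝ → ℝ} (hf : Continuous f) {a x : ℝ}
    (h : ∀ r, a < r → x ≤ f r) : x ≤ f a :=
  ge_of_tendsto ((hf.tendsto a).mono_left nhdsWithin_le_nhds)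
    (eventually_nhdsWithin_of_forall (s := Set.Ioi a) h)

section WordEstimates

variable {H : Type*} [NormedAddCommGroup H] [NormedSpace ℂ H]

theorem norm_map_list_prod_le (σ : Z →ₐ[ℂ] (H →L[ℂ] H)) {K : ℝ} (hK : 0 ≤ K)
    (hσ : ∀ z, ‖σ z‖ ≤ K * ‖z‖) (l : List Z) :
    ‖σ l.prod‖ ≤ K ^ l.length * (l.map norm).prod := by
  induction l with
  | nil => simpa [ContinuousLinearMap.one_def] using ContinuousLinearMap.norm_id_le
  | cons x l ih =>
    simp only [List.prod_cons, map_mul, List.length_cons, List.map_cons]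
    calc ‖σ x * σ l.prod‖ ≤ ‖σ x‖ * ‖σ l.prod‖ := norm_mul_le _ _
      _ ≤ (K * ‖x‖) * (K ^ l.length * (l.map norm).prod) :=
          mul_le_mul (hσ x) ih (norm_nonneg _) (by positivity)
      _ = _ := by ring

/-- The Leibniz estimate for a word, multiplied by `K` to avoid a truncated exponent. -/
theorem mul_norm_derivation_list_prod_le (σ : Z →ₐ[ℂ] (H →L[ℂ] H)) {K t : ℝ} (hK : 0 ≤ K)
    (hσ : ∀ z, ‖σ z‖ ≤ K * ‖z‖) (Δ : Z →ₗ[ℂ] (H →L[ℂ] H))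
    (hLeib : ∀ z₁ z₂ : Z, Δ (z₁ * z₂) = σ z₁ * Δ z₂ + Δ z₁ * σ z₂) (ht : 0 ≤ t)
    (l : List Z) (hl : ∀ x ∈ l, ‖Δ x‖ ≤ t * ‖x‖) :
    K * ‖Δ l.prod‖ ≤ l.length * K ^ l.length * t * (l.map norm).prod := by
  induction l with
  | nil =>
    have h : Δ 1 = 0 := by simpa using hLeib 1 1
    simp [h]
  | cons x l ih =>
    have ih := ih fun y hy => hl y (List.mem_cons_of_mem _ hy)
    have hx := hl x List.mem_cons_self
    simp only [List.prod_cons, hLeib, List.length_cons, List.map_cons]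
    calc K * ‖σ x * Δ l.prod + Δ x * σ l.prod‖
        ≤ K * (‖σ x‖ * ‖Δ l.prod‖ + ‖Δ x‖ * ‖σ l.prod‖) := by
          gcongr
          exact (norm_add_le _ _).trans (add_le_add (norm_mul_le _ _) (norm_mul_le _ _))
      _ = ‖σ x‖ * (K * ‖Δ l.prod‖) + K * (‖Δ x‖ * ‖σ l.prod‖) := by ring
      _ ≤ (K * ‖x‖) * (l.length * K ^ l.length * t * (l.map norm).prod)
          + K * ((t * ‖x‖) * (K ^ l.length * (l.map norm).prod)) := by
          have hσl := norm_map_list_prod_le σ hK hσ l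
          exact add_le_add (mul_le_mul (hσ x) ih (by positivity) (by positivity))
            (mul_le_mul_of_nonneg_left
              (mul_le_mul hx hσl (norm_nonneg _) (by positivity)) hK)
      _ = _ := by push_cast; ring

theorem norm_derivation_ofFn_prod_le (σ : Z →ₐ[ℂ] (H →L[ℂ] H)) {K t : ℝ} (hK : 0 < K)
    (hσ : ∀ z, ‖σ z‖ ≤ K * ‖z‖) (Δ : Z →ₗ[ℂ] (H →L[ℂ] H))
    (hLeib : ∀ z₁ z₂ : Z, Δ (z₁ * z₂) = σ z₁ * Δ z₂ + Δ z₁ * σ z₂) (ht : 0 ≤ t)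
    {d : ℕ} (hd : 1 ≤ d) (x : Fin d → Z) (hx : ∀ i, ‖Δ (x i)‖ ≤ t * ‖x i‖) :
    ‖Δ (List.ofFn x).prod‖ ≤ d * K ^ (d - 1) * t * ∏ j, ‖x j‖ := by
  have h := mul_norm_derivation_list_prod_le σ hK.le hσ Δ hLeib ht (List.ofFn x)
    (by simpa [List.mem_ofFn] using hx)
  rw [List.length_ofFn, List.map_ofFn, List.prod_ofFn] at h
  refine le_of_mul_le_mul_left (h.trans_eq ?_) hK
  rw [← mul_pow_sub_one (by lia : d ≠ 0) K]
  simp only [Function.comp_apply]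
  ring

end WordEstimates

/-- Under the length-`d` approximate factorization property with constant `C`,
every bounded `σ`-derivation `Δ : Z → B(H)` satisfies
`‖Δ‖ ≤ C · d · max(‖σ‖, 1)^(d−1) · max(‖Δ|_A‖, ‖Δ|_B‖)`. -/
theorem norm_derivation_le_of_length_le
    {H : Type*} [NormedAddCommGroup H] [InnerProductSpace ℂ H] [CompleteSpace H]
    (A B : Subalgebra ℂ Z) (d : ℕ) (hd : 1 ≤ d) (C : ℝ)
    (hfact : ∀ z : Z, ‖z‖ < 1 → ∀ ε : ℝ, 0 < ε →
      ∃ (x y : Fin d → Z), AltB A B x ∧ AltA A B y ∧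
        (∏ j, ‖x j‖) + (∏ j, ‖y j‖) < C ∧
        ‖z - (List.ofFn x).prod - (List.ofFn y).prod‖ < ε)
    (σ : Z →ₐ[ℂ] (H →L[ℂ] H)) (s : ℝ) (hσ : ∀ z, ‖σ z‖ ≤ s * ‖z‖)
    (Δ : Z →ₗ[ℂ] (H →L[ℂ] H)) (M : ℝ) (hΔbdd : ∀ z, ‖Δ z‖ ≤ M * ‖z‖)
    (hLeib : ∀ z₁ z₂ : Z, Δ (z₁ * z₂) = σ z₁ * Δ z₂ + Δ z₁ * σ z₂)
    (t : ℝ) (ht : 0 ≤ t)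
    (htA : ∀ a ∈ A, ‖Δ a‖ ≤ t * ‖a‖) (htB : ∀ b ∈ B, ‖Δ b‖ ≤ t * ‖b‖) :
    ∀ z : Z, ‖Δ z‖ ≤ C * d * max s 1 ^ (d - 1) * t * ‖z‖ := by
  set K := max s 1
  have hK : 0 < K := lt_max_of_lt_right one_pos
  have hσK z : ‖σ z‖ ≤ K * ‖z‖ := (hσ z).trans (by gcongr; exact le_max_left _ _)
  have mem_or (i : ℕ) : i % 2 = 0 ∨ i % 2 = 1 := Nat.mod_two_eq_zero_or_one i
  have unit_ball (z : Z) (hz : ‖z‖ < 1) : ‖Δ z‖ ≤ C * d * K ^ (d - 1) * t := by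
    suffices h : ∀ ε : ℝ, 0 < ε → ‖Δ z‖ ≤ |M| * ε + C * d * K ^ (d - 1) * t by
      simpa using le_of_continuous_of_forall_gt
        (f := fun ε => |M| * ε + C * d * K ^ (d - 1) * t) (by fun_prop) h
    intro ε hε
    obtain ⟨x, y, hx, hy, hC, hz⟩ := hfact z hz ε hε
    have hΔx := norm_derivation_ofFn_prod_le σ hK hσK Δ hLeib ht hd x fun i =>
      (mem_or i).elim (fun h => htB _ ((hx i).1 h)) (fun h => htA _ ((hx i).2 h))
    have hΔy := norm_derivation_ofFn_prod_le σ hK hσK Δ hLeib ht hd y fun i =>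
      (mem_or i).elim (fun h => htA _ ((hy i).1 h)) (fun h => htB _ ((hy i).2 h))
    set p := (List.ofFn x).prod
    set q := (List.ofFn y).prod
    have herr : ‖Δ (z - p - q)‖ ≤ |M| * ε :=
      (hΔbdd _).trans (mul_le_mul (le_abs_self M) hz.le (norm_nonneg _) (abs_nonneg M))
    calc ‖Δ z‖ = ‖Δ (z - p - q) + Δ p + Δ q‖ := by simp only [map_sub]; abel_nf
      _ ≤ ‖Δ (z - p - q)‖ + ‖Δ p‖ + ‖Δ q‖ := norm_add₃_le
      _ ≤ |M| * ε + (d * K ^ (d - 1) * t) * ((∏ j, ‖x j‖) + ∏ j, ‖y j‖) := by linarith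
      _ ≤ |M| * ε + (d * K ^ (d - 1) * t) * C := by gcongr
      _ = _ := by ring
  intro z
  refine le_of_continuous_of_forall_gt (f := fun r => C * d * K ^ (d - 1) * t * r)
    (by fun_prop) fun r hr => ?_
  have hr0 : 0 < r := (norm_nonneg z).trans_lt hr
  have hnorm : ‖((r⁻¹ : ℝ) : ℂ)‖ = r⁻¹ := by
    rw [Complex.norm_real, Real.norm_of_nonneg (by positivity)]
  have h := unit_ball (((r⁻¹ : ℝ) : ℂ) • z) (by
    rw [norm_smul, hnorm, inv_mul_lt_iff₀ hr0]
    simpa using hr)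
  rw [map_smul, norm_smul, hnorm, inv_mul_le_iff₀ hr0] at h
  linarith
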